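/- arXiv:math/9808057 — 2 statements merged into one kernel-verified Lean document; each statement's English description precedes it below -/
import Mathlib

section
/- Let m, n be positive integers and A ∈ M_{m,n}(ℝ). Then A is badly approximable if and only if there exists ε > 0 such that for all t ≥ 0 and all (p,q) ∈ ℤ^m × ℤ^n with (p,q) ≠ (0,0) one has max( e^{t/m}·‖Aq + p‖ , e^{-t/n}·‖q‖ ) ≥ ε. -/
open MeasureTheory Filter

noncomputable section

/-- The vector of real entries of an integer vector. -/
def intCast {k : ℕ} (q : Fin k → ℤ) : Fin k → ℝ := fun i => (q i : ℝ)

/-- The value `Aq + p` of the system of linear forms `A` at `q`, shifted by `p`. -/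
def linForm {m n : ℕ} (A : Fin m → Fin n → ℝ)
    (q : Fin n → ℤ) (p : Fin m → ℤ) : Fin m → ℝ :=
  fun i => (∑ j, A i j * (q j : ℝ)) + (p i : ℝ)

/-- The system of linear forms `A` is badly approximable if
`‖Aq + p‖^m ‖q‖^n ≥ c > 0` for all `p ∈ ℤ^m` and all `q ∈ ℤ^n` of sufficiently
large norm.  (Here `‖·‖` is the sup norm.) -/
def IsBadlyApproximableLin {m n : ℕ} (A : Fin m → Fin n → ℝ) : Prop :=
  ∃ c > (0 : ℝ), ∃ T : ℝ, ∀ p : Fin m → ℤ, ∀ q : Fin n → ℤ,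
    T ≤ ‖intCast q‖ → c ≤ ‖linForm A q p‖ ^ m * ‖intCast q‖ ^ n

lemma one_le_norm_intCast {k : ℕ} {q : Fin k → ℤ} (hq : q ≠ 0) : 1 ≤ ‖intCast q‖ := by
  obtain ⟨i, hi⟩ := Function.ne_iff.mp hq
  have h : (1 : ℝ) ≤ |(q i : ℝ)| := by exact_mod_cast Int.one_le_abs hi
  exact h.trans (norm_le_pi_norm (intCast q) i)

lemma intCast_zero {k : ℕ} : intCast (0 : Fin k → ℤ) = 0 := by
  ext i
  simp [intCast]

lemma intCast_nsmul {k : ℕ} (N : ℕ) (q : Fin k → ℤ) :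
    intCast (N • q) = (N : ℝ) • intCast q := by
  ext i
  simp [intCast]

lemma linForm_zero {m n : ℕ} (A : Fin m → Fin n → ℝ) (p : Fin m → ℤ) :
    linForm A 0 p = intCast p := by
  ext i
  simp [linForm, intCast]

lemma linForm_nsmul {m n : ℕ} (A : Fin m → Fin n → ℝ) (N : ℕ) (q : Fin n → ℤ)
    (p : Fin m → ℤ) : linForm A (N • q) (N • p) = (N : ℝ) • linForm A q p := by
  ext i
  simp only [linForm, Pi.smul_apply, nsmul_eq_mul, smul_eq_mul, Int.cast_mul, Int.cast_natCast,
    mul_add, Finset.mul_sum]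
  congr 1
  exact Finset.sum_congr rfl fun j _ => by ring

/-- The lower bound defining bad approximability extends, with a smaller constant, to all nonzero
integer vectors: replace `(p, q)` by a large multiple. -/
lemma IsBadlyApproximableLin.exists_forall_ne_zero {m n : ℕ} {A : Fin m → Fin n → ℝ}
    (hA : IsBadlyApproximableLin A) :
    ∃ c > (0 : ℝ), ∀ p : Fin m → ℤ, ∀ q : Fin n → ℤ, q ≠ 0 →
      c ≤ ‖linForm A q p‖ ^ m * ‖intCast q‖ ^ n := by
  obtain ⟨c, hc, T, h⟩ := hA
  obtain ⟨N, hN⟩ := exists_nat_ge (max T 1)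
  have hN1 : (1 : ℝ) ≤ N := (le_max_right _ _).trans hN
  have hpos : (0 : ℝ) < (N : ℝ) ^ (m + n) := by positivity
  refine ⟨c / (N : ℝ) ^ (m + n), by positivity, fun p q hq => ?_⟩
  have hq1 := one_le_norm_intCast hq
  have key := h (N • p) (N • q) (by
    rw [intCast_nsmul, norm_smul, Real.norm_natCast]
    have := (le_max_left _ _).trans hN
    nlinarith)
  rw [intCast_nsmul, linForm_nsmul, norm_smul, norm_smul, Real.norm_natCast] at key
  rw [div_le_iff₀ hpos]
  calc c ≤ _ := key
    _ = _ := by ring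

lemma exp_div_natCast_pow {m : ℕ} (hm : 0 < m) (t : ℝ) :
    Real.exp (t / m) ^ m = Real.exp t := by
  rw [← Real.exp_nat_mul, mul_div_cancel₀ t (by positivity)]

/-- The product of the two weighted quantities does not depend on the time `t`. -/
lemma exp_weighted_pow_mul_pow {m n : ℕ} (hm : 0 < m) (hn : 0 < n) (t x y : ℝ) :
    (Real.exp (t / m) * x) ^ m * (Real.exp (-t / n) * y) ^ n = x ^ m * y ^ n := by
  rw [mul_pow, mul_pow, exp_div_natCast_pow hm, exp_div_natCast_pow hn]
  calc _ = Real.exp t * Real.exp (-t) * (x ^ m * y ^ n) := by ring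
    _ = _ := by rw [← Real.exp_add]; simp

/-- Dani's correspondence: `A` is badly approximable iff there is `ε > 0` with
`max(e^{t/m}‖Aq + p‖, e^{-t/n}‖q‖) ≥ ε` for all `t ≥ 0` and all nonzero
`(p, q) ∈ ℤ^m × ℤ^n`. -/
theorem badly_approximable_iff_dani (m n : ℕ) (hm : 0 < m) (hn : 0 < n)
    (A : Fin m → Fin n → ℝ) :
    IsBadlyApproximableLin A ↔
      ∃ ε > (0 : ℝ), ∀ t : ℝ, 0 ≤ t → ∀ p : Fin m → ℤ, ∀ q : Fin n → ℤ,
        (p, q) ≠ (0, 0) →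
        ε ≤ max (Real.exp (t / m) * ‖linForm A q p‖)
                (Real.exp (-t / n) * ‖intCast q‖) := by
  constructor
  · intro hA
    obtain ⟨c, hc, h⟩ := hA.exists_forall_ne_zero
    refine ⟨min 1 c, by positivity, fun t ht p q hpq => ?_⟩
    by_cases hq : q = 0
    · subst hq
      have hp : p ≠ 0 := fun hp => hpq (by rw [hp])
      rw [linForm_zero]
      refine (min_le_left _ _).trans (le_max_of_le_left ?_)
      exact one_le_mul_of_one_le_of_one_le (Real.one_le_exp (by positivity))
        (one_le_norm_intCast hp)
    · by_contra! hlt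
      set M := max (Real.exp (t / m) * ‖linForm A q p‖) (Real.exp (-t / n) * ‖intCast q‖)
      have hM0 : 0 ≤ M := le_max_of_le_left (by positivity)
      have hM1 : M ≤ 1 := (hlt.trans_le (min_le_left _ _)).le
      have hcM : c ≤ M := calc
        c ≤ ‖linForm A q p‖ ^ m * ‖intCast q‖ ^ n := h p q hq
        _ = (Real.exp (t / m) * ‖linForm A q p‖) ^ m *
            (Real.exp (-t / n) * ‖intCast q‖) ^ n :=
          (exp_weighted_pow_mul_pow hm hn t _ _).symm
        _ ≤ M ^ m * M ^ n := by
          gcongr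
          · exact le_max_left _ _
          · exact le_max_right _ _
        _ = M ^ (m + n) := (pow_add _ _ _).symm
        _ ≤ M := pow_le_of_le_one hM0 hM1 (by omega)
      exact absurd hcM (hlt.trans_le (min_le_right _ _)).not_ge
  · rintro ⟨ε, hε, h⟩
    refine ⟨ε ^ m * (ε / 2) ^ n, by positivity, ε, fun p q hqε => ?_⟩
    have hq0 : 0 < ‖intCast q‖ := hε.trans_le hqε
    have hpq : (p, q) ≠ (0, 0) := by
      intro h0
      rw [(Prod.mk.inj h0).2, intCast_zero, norm_zero] at hq0
      exact hq0.false
    set t : ℝ := n * Real.log (‖intCast q‖ / (ε / 2))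
    have ht : 0 ≤ t := mul_nonneg n.cast_nonneg
      (Real.log_nonneg ((one_le_div (by positivity)).mpr (by linarith)))
    have hn0 : (n : ℝ) ≠ 0 := by positivity
    have hqt : Real.exp (-t / n) * ‖intCast q‖ = ε / 2 := by
      rw [neg_div, mul_div_cancel_left₀ _ hn0, Real.exp_neg, Real.exp_log (by positivity)]
      field_simp
    have hlin : ε ≤ Real.exp (t / m) * ‖linForm A q p‖ := by
      refine (le_max_iff.mp (h t ht p q hpq)).resolve_right ?_
      rw [hqt]
      linarith
    rw [← exp_weighted_pow_mul_pow hm hn t ‖linForm A q p‖, hqt]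
    gcongr
end
end

section
/- Let m, n be positive integers. For every A ∈ M_{m,n}(ℝ), the constant c_A, defined as the liminf over pairs (p,q) ∈ ℤ^m × ℤ^n with ‖q‖ → ∞ of ‖Aq + p‖^m · ‖q‖^n, satisfies c_A < 1. -/
open MeasureTheory Filter

noncomputable section

/-- The filter of pairs `(p, q) ∈ ℤ^m × ℤ^n` with `‖q‖ → ∞`. -/
def qTop (m n : ℕ) : Filter ((Fin m → ℤ) × (Fin n → ℤ)) :=
  Filter.comap (fun v => ‖intCast v.2‖) Filter.atTop

/-- The weighted sum `m‖x‖ + n‖y‖` of the sup norms of the two blocks of `v = (x, y)`. -/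
def blockNorm (m n : ℕ) (v : Fin m ⊕ Fin n → ℝ) : ℝ :=
  m * ‖fun i => v (Sum.inl i)‖ + n * ‖fun j => v (Sum.inr j)‖

lemma continuous_blockNorm (m n : ℕ) : Continuous (blockNorm m n) := by
  unfold blockNorm
  fun_prop

lemma blockNorm_add_le {m n : ℕ} (v w : Fin m ⊕ Fin n → ℝ) :
    blockNorm m n (v + w) ≤ blockNorm m n v + blockNorm m n w := by
  have h₁ : ‖fun i => (v + w) (Sum.inl i)‖ ≤ ‖fun i => v (Sum.inl i)‖ + ‖fun i => w (Sum.inl i)‖ :=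
    norm_add_le (fun i => v (Sum.inl i)) (fun i => w (Sum.inl i))
  have h₂ : ‖fun i => (v + w) (Sum.inr i)‖ ≤ ‖fun i => v (Sum.inr i)‖ + ‖fun i => w (Sum.inr i)‖ :=
    norm_add_le (fun i => v (Sum.inr i)) (fun i => w (Sum.inr i))
  have h₁' := mul_le_mul_of_nonneg_left h₁ (Nat.cast_nonneg (α := ℝ) m)
  have h₂' := mul_le_mul_of_nonneg_left h₂ (Nat.cast_nonneg (α := ℝ) n)
  unfold blockNorm
  linarith

lemma blockNorm_smul {m n : ℕ} (c : ℝ) (v : Fin m ⊕ Fin n → ℝ) :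
    blockNorm m n (c • v) = |c| * blockNorm m n v := by
  have h₁ : ‖fun i => (c • v) (Sum.inl i)‖ = |c| * ‖fun i => v (Sum.inl i)‖ :=
    norm_smul c (fun i => v (Sum.inl i))
  have h₂ : ‖fun i => (c • v) (Sum.inr i)‖ = |c| * ‖fun i => v (Sum.inr i)‖ :=
    norm_smul c (fun i => v (Sum.inr i))
  rw [blockNorm, h₁, h₂, blockNorm]
  ring

lemma convex_blockNorm_lt (m n : ℕ) (R : ℝ) : Convex ℝ {v | blockNorm m n v < R} := by
  have h : ConvexOn ℝ Set.univ (blockNorm m n) := by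
    refine ⟨convex_univ, fun x _ y _ a b ha hb _ => (blockNorm_add_le _ _).trans ?_⟩
    simp [blockNorm_smul, abs_of_nonneg ha, abs_of_nonneg hb]
  simpa using h.convex_lt R

lemma two_pow_lt_volume_blockNorm_lt {m n : ℕ} (hm : 0 < m) (hn : 0 < n) :
    (2 : ENNReal) ^ (m + n) < volume {v | blockNorm m n v < m + n} := by
  have hm' : (0 : ℝ) < m := by exact_mod_cast hm
  have hn' : (0 : ℝ) < n := by exact_mod_cast hn
  have : Nonempty (Fin n) := ⟨⟨0, hn⟩⟩
  set U : Set (Fin m ⊕ Fin n → ℝ) :=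
    {v | blockNorm m n v < m + n} ∩ {v | 1 < ‖fun j => v (Sum.inr j)‖} with hU
  have hUo : IsOpen U :=
    (isOpen_lt (continuous_blockNorm m n) continuous_const).inter
      (isOpen_lt continuous_const (by fun_prop))
  have hUne : U.Nonempty := by
    refine ⟨Sum.elim 0 (fun _ => 1 + m / (2 * n)), ?_, ?_⟩
    · have h0 : ‖fun _ : Fin m => (0 : ℝ)‖ = 0 := norm_zero
      simp only [Set.mem_ofPred_eq, blockNorm, Sum.elim_inl, Sum.elim_inr, Pi.zero_apply,
        pi_norm_const, h0]
      rw [Real.norm_of_nonneg (by positivity)]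
      field_simp
      linarith
    · simp only [Set.mem_ofPred_eq, Sum.elim_inr, pi_norm_const]
      rw [Real.norm_of_nonneg (by positivity)]
      have : (0 : ℝ) < m / (2 * n) := by positivity
      linarith
  have hnorm (v : Fin m ⊕ Fin n → ℝ) :
      ‖fun i => v (Sum.inl i)‖ ≤ ‖v‖ ∧ ‖fun j => v (Sum.inr j)‖ ≤ ‖v‖ :=
    ⟨(pi_norm_le_iff_of_nonneg (norm_nonneg v)).2 fun i => norm_le_pi_norm v _,
      (pi_norm_le_iff_of_nonneg (norm_nonneg v)).2 fun i => norm_le_pi_norm v _⟩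
  have hdisj : Disjoint (Metric.ball (0 : Fin m ⊕ Fin n → ℝ) 1) U := by
    refine Set.disjoint_left.2 fun v hv hvU => ?_
    have h1 : 1 < ‖fun j => v (Sum.inr j)‖ := hvU.2
    have h2 : ‖v‖ < 1 := by simpa using hv
    linarith [(hnorm v).2]
  have hsub : Metric.ball (0 : Fin m ⊕ Fin n → ℝ) 1 ∪ U ⊆ {v | blockNorm m n v < m + n} := by
    refine Set.union_subset (fun v hv => ?_) Set.inter_subset_left
    have h2 : ‖v‖ < 1 := by simpa using hv
    have h3 := mul_lt_mul_of_pos_left ((hnorm v).1.trans_lt h2) hm'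
    have h4 := mul_lt_mul_of_pos_left ((hnorm v).2.trans_lt h2) hn'
    simp only [Set.mem_ofPred_eq, blockNorm]
    linarith
  have hball : volume (Metric.ball (0 : Fin m ⊕ Fin n → ℝ) 1) = 2 ^ (m + n) := by
    rw [Real.volume_pi_ball _ one_pos, ENNReal.ofReal_pow (by norm_num)]
    simp
  calc (2 : ENNReal) ^ (m + n) < 2 ^ (m + n) + volume U :=
        ENNReal.lt_add_right (by finiteness) (hUo.measure_pos volume hUne).ne'
    _ = volume (Metric.ball (0 : Fin m ⊕ Fin n → ℝ) 1 ∪ U) := by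
        rw [measure_union hdisj hUo.measurableSet, hball]
    _ ≤ _ := measure_mono hsub

lemma exists_two_pow_lt_volume_blockNorm_lt {m n : ℕ} (hm : 0 < m) (hn : 0 < n) :
    ∃ r : ℝ, 0 < r ∧ r < 1 ∧
      (2 : ENNReal) ^ (m + n) < volume {v | blockNorm m n v < (m + n) * r} := by
  have hV := two_pow_lt_volume_blockNorm_lt hm hn
  set V := volume {v | blockNorm m n v < m + n} with hVdef
  have hlim : Tendsto (fun r : ℝ => ENNReal.ofReal (|r ^ (m + n)|) * V) (nhdsWithin 1 (Set.Iio 1)) (nhds V) := by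
    have h1 : Tendsto (fun r : ℝ => ENNReal.ofReal (|r ^ (m + n)|)) (nhdsWithin 1 (Set.Iio 1)) (nhds 1) := by
      have h2 : Continuous fun r : ℝ => ENNReal.ofReal (|r ^ (m + n)|) :=
        ENNReal.continuous_ofReal.comp (by fun_prop)
      simpa using (h2.tendsto 1).mono_left nhdsWithin_le_nhds
    simpa using ENNReal.Tendsto.mul_const (b := V) h1 (Or.inl one_ne_zero)
  have hpos : ∀ᶠ r : ℝ in nhdsWithin 1 (Set.Iio 1), 0 < r :=
    nhdsWithin_le_nhds (eventually_gt_nhds one_pos)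
  obtain ⟨r, ⟨hr, hr0⟩, hr1⟩ :=
    (((hlim.eventually_const_lt hV).and hpos).and self_mem_nhdsWithin).exists
  refine ⟨r, hr0, hr1, hr.trans_le ?_⟩
  have hfin : Module.finrank ℝ (Fin m ⊕ Fin n → ℝ) = m + n := by simp
  rw [hVdef, ← hfin, ← Measure.addHaar_smul]
  refine measure_mono ?_
  rintro _ ⟨v, hv, rfl⟩
  have hv' : blockNorm m n v < m + n := hv
  simp only [Set.mem_ofPred_eq, blockNorm_smul, abs_of_pos hr0]
  nlinarith

lemma pow_mul_pow_le_of_weighted_le {m n : ℕ} (hm : 0 < m) {x y r : ℝ} (hx : 0 ≤ x)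
    (hy : 0 ≤ y) (h : m * x + n * y ≤ (m + n) * r) : x ^ m * y ^ n ≤ r ^ (m + n) := by
  have hm' : (0 : ℝ) < m := by exact_mod_cast hm
  have hd : (0 : ℝ) < m + n := by positivity
  have hamgm := Real.geom_mean_le_arith_mean2_weighted (w₁ := m / (m + n)) (w₂ := n / (m + n))
    (by positivity) (by positivity) hx hy (by field_simp)
  have hle : x ^ ((m : ℝ) / (m + n)) * y ^ ((n : ℝ) / (m + n)) ≤ r := by
    refine hamgm.trans ?_
    have : (m : ℝ) / (m + n) * x + n / (m + n) * y = (m * x + n * y) / (m + n) := by ring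
    rw [this, div_le_iff₀ hd]
    linarith
  have hpow := pow_le_pow_left₀ (by positivity) hle (m + n)
  rw [mul_pow, ← Real.rpow_mul_natCast hx, ← Real.rpow_mul_natCast hy] at hpow
  push_cast at hpow
  rwa [div_mul_cancel₀ _ hd.ne', div_mul_cancel₀ _ hd.ne', Real.rpow_natCast,
    Real.rpow_natCast] at hpow

/-- The matrix of `(p, q) ↦ (a (p + Aq), b q)`. -/
def flowMatrix {m n : ℕ} (A : Fin m → Fin n → ℝ) (a b : ℝ) :
    Matrix (Fin m ⊕ Fin n) (Fin m ⊕ Fin n) ℝ :=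
  Matrix.fromBlocks (a • 1) (a • Matrix.of A) 0 (b • 1)

lemma det_flowMatrix {m n : ℕ} (A : Fin m → Fin n → ℝ) (a b : ℝ) :
    (flowMatrix A a b).det = a ^ m * b ^ n := by
  rw [flowMatrix, Matrix.det_fromBlocks_zero₂₁]
  simp

lemma flowMatrix_mulVec {m n : ℕ} (A : Fin m → Fin n → ℝ) (a b : ℝ)
    (p : Fin m → ℤ) (q : Fin n → ℤ) :
    (flowMatrix A a b).mulVec (Sum.elim (intCast p) (intCast q)) =
      Sum.elim (a • linForm A q p) (b • intCast q) := by
  rw [flowMatrix, Matrix.fromBlocks_mulVec]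
  congr 1
  · ext i
    simp [Matrix.smul_mulVec, Matrix.mulVec, dotProduct, linForm, intCast, mul_add, mul_assoc,
      Finset.mul_sum, add_comm]
  · ext i
    simp [Matrix.smul_mulVec]

lemma blockNorm_flowMatrix_mulVec {m n : ℕ} (A : Fin m → Fin n → ℝ) {a b : ℝ}
    (ha : 0 ≤ a) (hb : 0 ≤ b) (p : Fin m → ℤ) (q : Fin n → ℤ) :
    blockNorm m n ((flowMatrix A a b).mulVec (Sum.elim (intCast p) (intCast q))) =
      m * (a * ‖linForm A q p‖) + n * (b * ‖intCast q‖) := by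
  rw [flowMatrix_mulVec, blockNorm]
  simp only [Sum.elim_inl, Sum.elim_inr]
  rw [norm_smul, norm_smul, Real.norm_of_nonneg ha, Real.norm_of_nonneg hb]

/-- Minkowski's convex body theorem for `ℤ^ι`. -/
lemma exists_int_ne_zero_mem_of_two_pow_lt_volume {ι : Type*} [Fintype ι] {s : Set (ι → ℝ)}
    (hsymm : ∀ x ∈ s, -x ∈ s) (hconv : Convex ℝ s)
    (hvol : (2 : ENNReal) ^ Fintype.card ι < volume s) :
    ∃ z : ι → ℤ, z ≠ 0 ∧ (fun i => (z i : ℝ)) ∈ s := by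
  classical
  have hF : volume (ZSpan.fundamentalDomain (Pi.basisFun ℝ ι)) = 1 := by
    rw [ZSpan.fundamentalDomain_pi_basisFun, volume_pi, Measure.pi_pi]
    simp
  have : Countable (Submodule.span ℤ (Set.range (Pi.basisFun ℝ ι))).toAddSubgroup :=
    inferInstanceAs (Countable (Submodule.span ℤ (Set.range (Pi.basisFun ℝ ι))))
  obtain ⟨⟨x, hx⟩, hx0, hxs⟩ := exists_ne_zero_mem_lattice_of_measure_mul_two_pow_lt_measure
    (ZSpan.isAddFundamentalDomain' (Pi.basisFun ℝ ι) volume) hsymm hconv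
    (by rw [hF, one_mul, Module.finrank_fintype_fun_eq_card]; exact hvol)
  have hint := ((Pi.basisFun ℝ ι).mem_span_iff_repr_mem ℤ x).1 hx
  choose z hz using hint
  have hzx : (fun i => (z i : ℝ)) = x := funext fun i => by simpa using hz i
  refine ⟨z, ?_, by rw [hzx]; exact hxs⟩
  rintro rfl
  exact hx0 (Subtype.ext (hzx.symm.trans (by ext; simp)))

lemma exists_weighted_lt_of_two_pow_lt_volume {m n : ℕ} (A : Fin m → Fin n → ℝ) {R a b : ℝ}
    (hvol : (2 : ENNReal) ^ (m + n) < volume {v | blockNorm m n v < R})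
    (ha : 0 ≤ a) (hb : 0 ≤ b) (hab : a ^ m * b ^ n = 1) :
    ∃ v : (Fin m → ℤ) × (Fin n → ℤ), v ≠ 0 ∧
      m * (a * ‖linForm A v.2 v.1‖) + n * (b * ‖intCast v.2‖) < R := by
  set T := Matrix.toLin' (flowMatrix A a b) with hT
  have hdet : LinearMap.det T = 1 := by rw [hT, LinearMap.det_toLin', det_flowMatrix, hab]
  have hvolT : volume (T ⁻¹' {v | blockNorm m n v < R}) = volume {v | blockNorm m n v < R} := by
    rw [Measure.addHaar_preimage_linearMap _ (by simp [hdet]), hdet]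
    simp
  obtain ⟨z, hz0, hz⟩ := exists_int_ne_zero_mem_of_two_pow_lt_volume
    (s := T ⁻¹' {v | blockNorm m n v < R})
    (fun x hx => by
      have h := blockNorm_smul (-1) (T x)
      simp only [Set.mem_preimage, Set.mem_ofPred_eq, map_neg] at hx ⊢
      rw [neg_one_smul] at h
      rw [h]
      simpa using hx)
    ((convex_blockNorm_lt m n R).linear_preimage T)
    (by rw [hvolT]; simpa using hvol)
  refine ⟨(fun i => z (Sum.inl i), fun j => z (Sum.inr j)), fun h => hz0 ?_, ?_⟩
  · rw [Prod.ext_iff] at h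
    ext (i | j)
    · exact congrFun h.1 i
    · exact congrFun h.2 j
  · rw [← blockNorm_flowMatrix_mulVec A ha hb]
    have he : (fun i => (z i : ℝ)) =
        Sum.elim (intCast fun i => z (Sum.inl i)) (intCast fun j => z (Sum.inr j)) := by
      ext (i | j) <;> rfl
    rw [he] at hz
    exact hz

lemma norm_intCast {k : ℕ} (q : Fin k → ℤ) : ‖intCast q‖ = ‖q‖ := by
  simp only [Pi.norm_def, intCast]
  norm_cast

lemma finite_norm_intCast_le (k : ℕ) (C : ℝ) : {q : Fin k → ℤ | ‖intCast q‖ ≤ C}.Finite := by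
  have h := (isCompact_closedBall (0 : Fin k → ℤ) C).finite_of_discrete
  refine h.subset fun q hq => ?_
  simpa [norm_intCast] using hq

lemma linForm_eq_add {m n : ℕ} (A : Fin m → Fin n → ℝ) (q : Fin n → ℤ) (p : Fin m → ℤ) :
    linForm A q p = linForm A q 0 + intCast p := by
  ext i
  simp [linForm, intCast]

lemma finite_norm_intCast_le_and_norm_linForm_le {m n : ℕ} (A : Fin m → Fin n → ℝ) (N C : ℝ) :
    {v : (Fin m → ℤ) × (Fin n → ℤ) | ‖intCast v.2‖ ≤ N ∧ ‖linForm A v.2 v.1‖ ≤ C}.Finite := by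
  refine ((finite_norm_intCast_le n N).biUnion fun q _ =>
    (finite_norm_intCast_le m (C + ‖linForm A q 0‖)).prod (Set.finite_singleton q)).subset ?_
  rintro ⟨p, q⟩ ⟨hq, hp⟩
  simp only [Set.mem_iUnion]
  refine ⟨q, hq, ?_, rfl⟩
  have h : intCast p = linForm A q p - linForm A q 0 := by
    rw [linForm_eq_add A q p, add_sub_cancel_left]
  rw [Set.mem_ofPred_eq, h]
  exact (norm_sub_le _ _).trans (by gcongr)

lemma exists_pos_le_norm_linForm {m n : ℕ} (A : Fin m → Fin n → ℝ)
    (hA : ∀ v : (Fin m → ℤ) × (Fin n → ℤ), v ≠ 0 → linForm A v.2 v.1 ≠ 0) (N : ℝ) :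
    ∃ ε > 0, ∀ v : (Fin m → ℤ) × (Fin n → ℤ), v ≠ 0 → ‖intCast v.2‖ ≤ N →
      ε ≤ ‖linForm A v.2 v.1‖ := by
  have hfin := (finite_norm_intCast_le_and_norm_linForm_le A N 1).subset
    (Set.sdiff_subset (t := {0}))
  rcases Set.eq_empty_or_nonempty
    ({v : (Fin m → ℤ) × (Fin n → ℤ) | ‖intCast v.2‖ ≤ N ∧ ‖linForm A v.2 v.1‖ ≤ 1} \ {0})
    with he | hne
  · refine ⟨1, one_pos, fun v hv hvN => ?_⟩
    by_contra! h
    exact (Set.eq_empty_iff_forall_notMem.1 he v) ⟨⟨hvN, h.le⟩, hv⟩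
  · obtain ⟨w, hw, hmin⟩ := Set.exists_min_image _ (fun v => ‖linForm A v.2 v.1‖) hfin hne
    refine ⟨‖linForm A w.2 w.1‖, norm_pos_iff.2 (hA w hw.2), fun v hv hvN => ?_⟩
    by_cases h : ‖linForm A v.2 v.1‖ ≤ 1
    · exact hmin v ⟨⟨hvN, h⟩, hv⟩
    · exact hw.1.2.trans (not_le.1 h).le

lemma exists_linForm_eq_zero_of_le {m n : ℕ} (A : Fin m → Fin n → ℝ)
    {v : (Fin m → ℤ) × (Fin n → ℤ)} (hv : v ≠ 0) (h : linForm A v.2 v.1 = 0) (N : ℝ) :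
    ∃ w : (Fin m → ℤ) × (Fin n → ℤ), N ≤ ‖intCast w.2‖ ∧ linForm A w.2 w.1 = 0 := by
  have hq : v.2 ≠ 0 := by
    intro hq
    refine hv (Prod.ext ?_ hq)
    ext i
    have hi := congrFun h i
    simpa [linForm, hq] using hi
  have hpos : 0 < ‖intCast v.2‖ := by
    rw [norm_intCast]
    exact norm_pos_iff.2 hq
  obtain ⟨k, hk⟩ := exists_nat_ge (N / ‖intCast v.2‖)
  refine ⟨(k : ℤ) • v, ?_, ?_⟩
  · have hsm : intCast ((k : ℤ) • v).2 = (k : ℝ) • intCast v.2 := by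
      ext i
      simp [intCast]
    rw [hsm, norm_smul, Real.norm_natCast]
    exact (div_le_iff₀ hpos).1 hk
  · have hsm : linForm A ((k : ℤ) • v).2 ((k : ℤ) • v).1 = (k : ℝ) • linForm A v.2 v.1 := by
      ext i
      simp only [linForm, Prod.smul_fst, Prod.smul_snd, Pi.smul_apply, smul_eq_mul, Int.cast_mul,
        Int.cast_natCast, mul_add, Finset.mul_sum]
      congr 1
      exact Finset.sum_congr rfl fun j _ => by ring
    rw [hsm, h, smul_zero]

lemma exists_le_norm_intCast_and_product_le {m n : ℕ} (hm : 0 < m) (hn : 0 < n)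
    (A : Fin m → Fin n → ℝ) {r : ℝ} (hr : 0 < r)
    (hvol : (2 : ENNReal) ^ (m + n) < volume {v | blockNorm m n v < (m + n) * r}) (N : ℝ) :
    ∃ v : (Fin m → ℤ) × (Fin n → ℤ), N ≤ ‖intCast v.2‖ ∧
      ‖linForm A v.2 v.1‖ ^ m * ‖intCast v.2‖ ^ n ≤ r ^ (m + n) := by
  have hm' : (0 : ℝ) < m := by exact_mod_cast hm
  by_cases hA : ∀ v : (Fin m → ℤ) × (Fin n → ℤ), v ≠ 0 → linForm A v.2 v.1 ≠ 0
  · obtain ⟨ε, hε, hmin⟩ := exists_pos_le_norm_linForm A hA N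
    obtain ⟨s, hs, hs0⟩ := (((tendsto_pow_atTop hn.ne').eventually_gt_atTop
      ((m + n) * r / (m * ε))).and (eventually_gt_atTop (0 : ℝ))).exists
    obtain ⟨v, hv0, hv⟩ := exists_weighted_lt_of_two_pow_lt_volume A hvol
      (a := s ^ n) (b := (s ^ m)⁻¹) (by positivity) (by positivity)
      (by rw [inv_pow, ← pow_mul, ← pow_mul, mul_comm n m]; exact mul_inv_cancel₀ (by positivity))
    refine ⟨v, ?_, ?_⟩
    · by_contra! hlt
      have h1 := hmin v hv0 hlt.le
      have h2 : (m + n) * r < s ^ n * (m * ε) := (div_lt_iff₀ (by positivity)).1 hs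
      have h3 : s ^ n * (m * ε) ≤ m * (s ^ n * ‖linForm A v.2 v.1‖) := by
        rw [mul_left_comm]
        gcongr
      have h4 : 0 ≤ n * ((s ^ m)⁻¹ * ‖intCast v.2‖) := by positivity
      linarith
    · have h := pow_mul_pow_le_of_weighted_le hm (by positivity) (by positivity) hv.le
      refine le_of_eq_of_le ?_ h
      rw [mul_pow, mul_pow, inv_pow, ← pow_mul, ← pow_mul, mul_comm n m]
      field_simp
  · push Not at hA
    obtain ⟨v, hv0, hv⟩ := hA
    obtain ⟨w, hw, hw0⟩ := exists_linForm_eq_zero_of_le A hv0 hv N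
    refine ⟨w, hw, ?_⟩
    rw [hw0, norm_zero, zero_pow hm.ne', zero_mul]
    positivity

/-- A consequence of Dirichlet's theorem: the constant
`c_A = liminf_{‖q‖ → ∞} ‖Aq + p‖^m ‖q‖^n` satisfies `c_A < 1` for every `A`. -/
theorem dirichlet_constant_lt_one (m n : ℕ) (hm : 0 < m) (hn : 0 < n)
    (A : Fin m → Fin n → ℝ) :
    liminf (fun v : (Fin m → ℤ) × (Fin n → ℤ) =>
        ‖linForm A v.2 v.1‖ ^ m * ‖intCast v.2‖ ^ n) (qTop m n) < 1 := by
  obtain ⟨r, hr0, hr1, hvol⟩ := exists_two_pow_lt_volume_blockNorm_lt hm hn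
  refine lt_of_le_of_lt ?_ (pow_lt_one₀ hr0.le hr1 (by omega : m + n ≠ 0))
  refine liminf_le_of_frequently_le ?_
    (isBoundedUnder_of ⟨0, fun v => by positivity⟩)
  rw [qTop, frequently_comap, frequently_atTop]
  intro N
  obtain ⟨v, hvN, hv⟩ := exists_le_norm_intCast_and_product_le hm hn A hr0 hvol N
  exact ⟨_, hvN, v, rfl, hv⟩
end
end
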